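/- Let 𝓚 be a finite set of simple path rules and 𝓕 a finite set of facts. Let x₀, x₁, …, x_k ∈ 𝓔 and r₁, …, r_k ∈ 𝓡 be such that 𝓚 ∪ 𝓕 ⊨ rᵢ(x_{i−1}, xᵢ) for every i ∈ {1,…,k}, and suppose that the relation r can be derived from the relation sequence r₁;…;r_k. Then 𝓚 ∪ 𝓕 ⊨ r(x₀, x_k). -/

import Mathlib

/-! Setting: finite relation symbols `R`, finite entities `E`.
A fact is a triple `(r, a, b) : R × E × E` meaning `r(a,b)`.
A simple path rule is a triple `(r, r₁, r₂) : R × R × R` meaning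
`r(X,Z) ← r₁(X,Y) ∧ r₂(Y,Z)`. -/

namespace SimplePath

variable {R E : Type*}

/-- One application of the immediate consequence operator. -/
def step (𝓚 : Set (R × R × R)) (S : Set (R × E × E)) : Set (R × E × E) :=
  S ∪ {x | ∃ r r₁ r₂ : R, ∃ a b c : E,
    x = (r, a, c) ∧ (r, r₁, r₂) ∈ 𝓚 ∧ (r₁, a, b) ∈ S ∧ (r₂, b, c) ∈ S}

/-- The sequence `𝓕₀ = 𝓕`, `𝓕ᵢ = 𝓕ᵢ₋₁ ∪ {r(a,c) : …}` of the immediate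
consequence operator. -/
def FIter (𝓚 : Set (R × R × R)) (𝓕 : Set (R × E × E)) : ℕ → Set (R × E × E)
  | 0 => 𝓕
  | i + 1 => step 𝓚 (FIter 𝓚 𝓕 i)

/-- `𝓚 ∪ 𝓕 ⊨ r(a,b)`: the atom belongs to the fixpoint `𝓕*` of the (nondecreasing,
eventually constant) sequence `𝓕ᵢ`, i.e. to some `𝓕ᵢ`. -/
def Entails (𝓚 : Set (R × R × R)) (𝓕 : Set (R × E × E)) (r : R) (a b : E) : Prop :=
  ∃ i : ℕ, (r, a, b) ∈ FIter 𝓚 𝓕 i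

/-- `IsRelPath 𝓕 a b [r₁, …, r_k]`: there is a relational path `r₁;…;r_k`
connecting `a` and `b` in the graph `G_𝓕`, i.e. facts
`r₁(a,x₁), r₂(x₁,x₂), …, r_k(x_{k-1},b)` all belonging to `𝓕`. -/
inductive IsRelPath (𝓕 : Set (R × E × E)) : E → E → List R → Prop
  | single {r : R} {a b : E} : (r, a, b) ∈ 𝓕 → IsRelPath 𝓕 a b [r]
  | cons {r : R} {a x b : E} {rs : List R} :
      (r, a, x) ∈ 𝓕 → IsRelPath 𝓕 x b rs → IsRelPath 𝓕 a b (r :: rs)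

/-- One-step derivation on sequences of relations: two adjacent relations
`r₁; r₂` are replaced by `s` when `𝓚` contains the rule `s(X,Z) ← r₁(X,Y) ∧ r₂(Y,Z)`. -/
inductive DeriveStep (𝓚 : Set (R × R × R)) : List R → List R → Prop
  | step {s r₁ r₂ : R} {p q : List R} :
      (s, r₁, r₂) ∈ 𝓚 → DeriveStep 𝓚 (p ++ r₁ :: r₂ :: q) (p ++ s :: q)

/-- `r` can be derived from the sequence `rs` by a sequence of one-step derivations. -/
def Derives (𝓚 : Set (R × R × R)) (rs : List R) (r : R) : Prop :=
  Relation.ReflTransGen (DeriveStep 𝓚) rs [r]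

end SimplePath

namespace SimplePath

variable {R E : Type*} {𝓚 : Set (R × R × R)} {𝓕 : Set (R × E × E)}

theorem FIter_mono (𝓚 : Set (R × R × R)) (𝓕 : Set (R × E × E)) : Monotone (FIter 𝓚 𝓕) :=
  monotone_nat_of_le_succ fun _ => Set.subset_union_left

theorem Entails.of_rule {s r₁ r₂ : R} {a b c : E} (hrule : (s, r₁, r₂) ∈ 𝓚)
    (h₁ : Entails 𝓚 𝓕 r₁ a b) (h₂ : Entails 𝓚 𝓕 r₂ b c) : Entails 𝓚 𝓕 s a c := by
  obtain ⟨i, hi⟩ := h₁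
  obtain ⟨j, hj⟩ := h₂
  exact ⟨max i j + 1, Or.inr ⟨s, r₁, r₂, a, b, c, rfl, hrule,
    FIter_mono 𝓚 𝓕 (le_max_left i j) hi, FIter_mono 𝓚 𝓕 (le_max_right i j) hj⟩⟩

/-- The entailed facts contain a path from `a` to `b` labelled by the given relation sequence. -/
def EntailsPath (𝓚 : Set (R × R × R)) (𝓕 : Set (R × E × E)) : List R → E → E → Prop
  | [], a, b => a = b
  | r :: rs, a, b => ∃ y, Entails 𝓚 𝓕 r a y ∧ EntailsPath 𝓚 𝓕 rs y b

theorem entailsPath_singleton {r : R} {a b : E} :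
    EntailsPath 𝓚 𝓕 [r] a b ↔ Entails 𝓚 𝓕 r a b := by
  simp [EntailsPath]

theorem EntailsPath.append_left {l l' : List R} {b : E}
    (h : ∀ a, EntailsPath 𝓚 𝓕 l a b → EntailsPath 𝓚 𝓕 l' a b) (p : List R) (a : E)
    (hp : EntailsPath 𝓚 𝓕 (p ++ l) a b) : EntailsPath 𝓚 𝓕 (p ++ l') a b := by
  induction p generalizing a with
  | nil => exact h a hp
  | cons r p ih =>
    obtain ⟨y, hr, hy⟩ := hp
    exact ⟨y, hr, ih y hy⟩

theorem EntailsPath.deriveStep {l l' : List R} {a b : E} (h : EntailsPath 𝓚 𝓕 l a b)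
    (hstep : DeriveStep 𝓚 l l') : EntailsPath 𝓚 𝓕 l' a b := by
  obtain ⟨hrule⟩ := hstep
  refine EntailsPath.append_left ?_ _ a h
  rintro c ⟨y, h₁, z, h₂, hq⟩
  exact ⟨z, h₁.of_rule hrule h₂, hq⟩

theorem EntailsPath.derives {l : List R} {r : R} {a b : E} (h : EntailsPath 𝓚 𝓕 l a b)
    (hder : Derives 𝓚 l r) : Entails 𝓚 𝓕 r a b := by
  refine entailsPath_singleton.mp ?_
  unfold Derives at hder
  generalize [r] = m at hder ⊢
  induction hder with
  | refl => exact h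
  | tail _ hstep ih => exact ih.deriveStep hstep

theorem entailsPath_ofFn (k : ℕ) (x : Fin (k + 1) → E) (rel : Fin k → R)
    (h : ∀ i : Fin k, Entails 𝓚 𝓕 (rel i) (x i.castSucc) (x i.succ)) :
    EntailsPath 𝓚 𝓕 (List.ofFn rel) (x 0) (x (Fin.last k)) := by
  induction k with
  | zero => simp [EntailsPath]
  | succ k ih =>
    rw [List.ofFn_succ]
    exact ⟨x 1, h 0, ih (fun i => x i.succ) (fun i => rel i.succ) fun i => h i.succ⟩

end SimplePath

open SimplePath in
/-- if `𝓚 ∪ 𝓕 ⊨ rᵢ(x_{i-1}, xᵢ)` for `i = 1, …, k` and `r` can be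
derived from the relation sequence `r₁;…;r_k`, then `𝓚 ∪ 𝓕 ⊨ r(x₀, x_k)`. -/
theorem entails_of_entailed_chain_derives
    {R E : Type*} [Fintype R] [Fintype E]
    (𝓚 : Set (R × R × R)) (𝓕 : Set (R × E × E))
    (k : ℕ) (x : Fin (k + 1) → E) (rel : Fin k → R) (r : R)
    (hchain : ∀ i : Fin k, Entails 𝓚 𝓕 (rel i) (x i.castSucc) (x i.succ))
    (hder : Derives 𝓚 (List.ofFn rel) r) :
    Entails 𝓚 𝓕 r (x 0) (x (Fin.last k)) := by
  exact (entailsPath_ofFn k x rel hchain).derives hder
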